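/- Let A be a unital ring that is an associative algebra over ℝ, let j : ℍ → A be a unital ℝ-algebra homomorphism, let T ∈ A, and let s, p ∈ ℍ with p ∉ [s] (i.e. not both Re p = Re s and ‖Im p‖ = ‖Im s‖). Let P_s, P_p ∈ A be idempotents, each commuting with T and with j(x) for every x ∈ ℍ, with P_s·P_p = 0 and P_p·P_s = 0 (this holds for the Riesz projections of the disjoint 2-spheres [s] and [p]). Assume u_s := 𝒬_s(T)·(1 − P_s) + P_s and u_p := 𝒬_p(T)·(1 − P_p) + P_p are invertible in A, and define the right and left Browder S-resolvents S_R := −(T − j(s̄))·(1 − P_s)·u_s⁻¹ − P_s and S_L := −u_p⁻¹·(T − j(p̄))·(1 − P_p) − P_p. Then the Browder S-resolvent equation holds: S_R·S_L·j(p² − 2(Re s)p + ‖s‖²) = (S_R − S_L)·j(p) + j(s̄)·(S_L − S_R) + [S_R·(T − j(p) − 1)·P_p − (T − j(s) − 1)·P_s·S_L]·j(p) + j(s̄)·[(T − j(s) − 1)·P_s·S_L − S_R·(T − j(p) − 1)·P_p]. -/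

import Mathlib

/-- `𝒬_q(T) = T² − 2(Re q)•T + ‖q‖²•1` in an associative unital ℝ-algebra. -/
noncomputable def QopA {A : Type*} [Ring A] [Algebra ℝ A] (T : A) (q : Quaternion ℝ) : A :=
  T ^ 2 - (2 * q.re) • T + (‖q‖ ^ 2) • (1 : A)

lemma map_mul_map_star {A : Type*} [Ring A] [Algebra ℝ A] (j : Quaternion ℝ →ₐ[ℝ] A)
    (q : Quaternion ℝ) : j q * j (star q) = (‖q‖ ^ 2) • (1 : A) := by
  rw [← map_mul, Quaternion.self_mul_star, Quaternion.normSq_eq_norm_mul_self, ← pow_two,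
    ← Quaternion.algebraMap_def, AlgHom.commutes, Algebra.algebraMap_eq_smul_one]

lemma map_star_mul_map {A : Type*} [Ring A] [Algebra ℝ A] (j : Quaternion ℝ →ₐ[ℝ] A)
    (q : Quaternion ℝ) : j (star q) * j q = (‖q‖ ^ 2) • (1 : A) := by
  rw [← map_mul, Quaternion.star_mul_self, Quaternion.normSq_eq_norm_mul_self, ← pow_two,
    ← Quaternion.algebraMap_def, AlgHom.commutes, Algebra.algebraMap_eq_smul_one]

lemma map_star_eq_sub {A : Type*} [Ring A] [Algebra ℝ A] (j : Quaternion ℝ →ₐ[ℝ] A)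
    (q : Quaternion ℝ) : j (star q) = (2 * q.re) • (1 : A) - j q := by
  rw [Quaternion.star_eq_two_re_sub, map_sub, ← Quaternion.algebraMap_def, AlgHom.commutes,
    Algebra.algebraMap_eq_smul_one]

/-- The left Browder `S`-resolvent equation. -/
lemma browder_left_resolvent_eq {A : Type*} [Ring A] [Algebra ℝ A]
    (j : Quaternion ℝ →ₐ[ℝ] A) (T : A) (q : Quaternion ℝ) (P : A)
    (hP : P ^ 2 = P) (hPT : P * T = T * P) (hPj : P * j q = j q * P)
    (u : Aˣ) (hu : (u : A) = QopA T q * (1 - P) + P) :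
    (-(((u⁻¹ : Aˣ) : A) * (T - j (star q)) * (1 - P)) - P) * j q
      = T * (-(((u⁻¹ : Aˣ) : A) * (T - j (star q)) * (1 - P)) - P)
        + 1 + (T - j q - 1) * P := by
  have hPP : P * P = P := by rw [← pow_two, hP]
  have hE : (1 - P) * P = 0 := by rw [sub_mul, one_mul, hPP, sub_self]
  have hEj : (1 - P) * j q = j q * (1 - P) := by rw [sub_mul, mul_sub, hPj, one_mul, mul_one]
  have hTu : Commute T (u : A) := by
    rw [hu]
    have hTP : Commute T P := hPT.symm
    have hTQ : Commute T (QopA T q) :=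
      (((Commute.refl T).pow_right 2).sub_right ((Commute.refl T).smul_right _)).add_right
        ((Commute.one_right T).smul_right _)
    exact (hTQ.mul_right ((Commute.one_right T).sub_right hTP)).add_right hTP
  have hTb : T * ((u⁻¹ : Aˣ) : A) = ((u⁻¹ : Aˣ) : A) * T := hTu.units_inv_right
  have hbP : ((u⁻¹ : Aˣ) : A) * P = P := by
    rw [Units.inv_mul_eq_iff_eq_mul, hu, add_mul, mul_assoc, hE, mul_zero, zero_add, hPP]
  have hbQ : ((u⁻¹ : Aˣ) : A) * QopA T q * (1 - P) = 1 - P := by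
    rw [mul_assoc, eq_sub_of_add_eq hu.symm, mul_sub, Units.inv_mul, hbP]
  have hQ : (T - j (star q)) * j q - T * (T - j (star q)) = -QopA T q := by
    have h1 : j q = (2 * q.re) • (1 : A) - j (star q) := by rw [map_star_eq_sub]; abel
    have h2 : T * j q = (2 * q.re) • T - T * j (star q) := by
      rw [h1, mul_sub, mul_smul_comm, mul_one]
    rw [sub_mul, mul_sub, map_star_mul_map, h2, QopA, pow_two T]
    abel
  generalize ((u⁻¹ : Aˣ) : A) = b at *
  have h3 : b * (T - j (star q)) * (1 - P) * j q - T * (b * (T - j (star q)) * (1 - P))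
      = -(1 - P) := by
    calc _ = b * ((T - j (star q)) * j q - T * (T - j (star q))) * (1 - P) := by
          rw [mul_assoc _ (1 - P), hEj, mul_sub b (_ * _), sub_mul _ _ (1 - P), ← mul_assoc b T,
            ← hTb]
          simp only [mul_assoc]
      _ = _ := by rw [hQ, mul_neg, neg_mul, hbQ]
  rw [sub_mul _ P, mul_sub T _ P, neg_mul, mul_neg, sub_eq_iff_eq_add.mp h3, hPj]
  noncomm_ring

/-- The right Browder `S`-resolvent equation. -/
lemma browder_right_resolvent_eq {A : Type*} [Ring A] [Algebra ℝ A]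
    (j : Quaternion ℝ →ₐ[ℝ] A) (T : A) (q : Quaternion ℝ) (P : A)
    (hP : P ^ 2 = P) (hPT : P * T = T * P)
    (u : Aˣ) (hu : (u : A) = QopA T q * (1 - P) + P) :
    j q * (-((T - j (star q)) * (1 - P) * ((u⁻¹ : Aˣ) : A)) - P)
      = (-((T - j (star q)) * (1 - P) * ((u⁻¹ : Aˣ) : A)) - P) * T
        + 1 + (T - j q - 1) * P := by
  have hPP : P * P = P := by rw [← pow_two, hP]
  have hTP : Commute T P := hPT.symm
  have hTE : Commute T (1 - P) := (Commute.one_right T).sub_right hTP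
  have hTQ : Commute T (QopA T q) :=
    (((Commute.refl T).pow_right 2).sub_right ((Commute.refl T).smul_right _)).add_right
      ((Commute.one_right T).smul_right _)
  have hPQ : Commute P (QopA T q) :=
    ((hTP.symm.pow_right 2).sub_right (hTP.symm.smul_right _)).add_right
      ((Commute.one_right P).smul_right _)
  have hTu : Commute T (u : A) := by
    rw [hu]
    exact (hTQ.mul_right hTE).add_right hTP
  have hTb : T * ((u⁻¹ : Aˣ) : A) = ((u⁻¹ : Aˣ) : A) * T := hTu.units_inv_right
  have hPb : P * ((u⁻¹ : Aˣ) : A) = P := by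
    rw [Units.mul_inv_eq_iff_eq_mul, hu, mul_add, ← mul_assoc, hPQ.eq, mul_assoc, mul_sub,
      mul_one, hPP, sub_self, mul_zero, zero_add]
  have hQb : QopA T q * (1 - P) * ((u⁻¹ : Aˣ) : A) = 1 - P := by
    rw [eq_sub_of_add_eq hu.symm, sub_mul, Units.mul_inv, hPb]
  have hQ : j q * (T - j (star q)) - (T - j (star q)) * T = -QopA T q := by
    have h1 : j q * T = (2 * q.re) • T - j (star q) * T := by
      rw [map_star_eq_sub, sub_mul, smul_mul_assoc, one_mul, sub_sub_cancel]
    rw [sub_mul, mul_sub, map_mul_map_star, h1, QopA, pow_two T]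
    abel
  generalize ((u⁻¹ : Aˣ) : A) = b at *
  have h3 : j q * ((T - j (star q)) * (1 - P) * b) - (T - j (star q)) * (1 - P) * b * T
      = -(1 - P) := by
    calc _ = (j q * (T - j (star q)) - (T - j (star q)) * T) * (1 - P) * b := by
          rw [mul_assoc _ b, ← hTb, ← mul_assoc _ T, mul_assoc _ (1 - P) T, ← hTE.eq]
          simp only [mul_assoc, sub_mul _ _ ((1 - P) * b)]
      _ = _ := by rw [hQ, neg_mul, neg_mul, hQb]
  rw [mul_sub _ _ P, sub_mul _ P T, neg_mul, mul_neg, sub_eq_iff_eq_add.mp h3, hPT]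
  noncomm_ring

theorem stmt11 {A : Type*} [Ring A] [Algebra ℝ A]
    (j : Quaternion ℝ →ₐ[ℝ] A) (T : A) (s p : Quaternion ℝ)
    (hps : ¬(p.re = s.re ∧ ‖p.im‖ = ‖s.im‖))
    (Ps Pp : A)
    (hPs : Ps ^ 2 = Ps) (hPp : Pp ^ 2 = Pp)
    (hPsT : Ps * T = T * Ps) (hPpT : Pp * T = T * Pp)
    (hPsj : ∀ x : Quaternion ℝ, Ps * j x = j x * Ps)
    (hPpj : ∀ x : Quaternion ℝ, Pp * j x = j x * Pp)
    (hsp : Ps * Pp = 0) (hpsz : Pp * Ps = 0)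
    (us up : Aˣ)
    (hus : (us : A) = QopA T s * (1 - Ps) + Ps)
    (hup : (up : A) = QopA T p * (1 - Pp) + Pp)
    (SR SL : A)
    (hSR : SR = -((T - j (star s)) * (1 - Ps) * ((us⁻¹ : Aˣ) : A)) - Ps)
    (hSL : SL = -(((up⁻¹ : Aˣ) : A) * (T - j (star p)) * (1 - Pp)) - Pp) :
    SR * SL * j (p ^ 2 - 2 * (s.re : Quaternion ℝ) * p + ((‖s‖ ^ 2 : ℝ) : Quaternion ℝ))
      = (SR - SL) * j p + j (star s) * (SL - SR)
        + (SR * (T - j p - 1) * Pp - (T - j s - 1) * Ps * SL) * j p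
        + j (star s) * ((T - j s - 1) * Ps * SL - SR * (T - j p - 1) * Pp) := by
  have hL := browder_left_resolvent_eq j T p Pp hPp hPpT (hPpj p) up hup
  have hR := browder_right_resolvent_eq j T s Ps hPs hPsT us hus
  rw [← hSL] at hL
  rw [← hSR] at hR
  have hKp : (T - j p - 1) * Pp = SL * j p - T * SL - 1 := by rw [hL]; abel
  have hKs : (T - j s - 1) * Ps = j s * SR - SR * T - 1 := by rw [hR]; abel
  have hpoly : j (p ^ 2 - 2 * (s.re : Quaternion ℝ) * p + ((‖s‖ ^ 2 : ℝ) : Quaternion ℝ))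
      = j p * j p - (2 * s.re) • j p + (‖s‖ ^ 2) • (1 : A) := by
    have hcoe (r : ℝ) : j (r : Quaternion ℝ) = r • (1 : A) := by
      rw [← Quaternion.algebraMap_def, AlgHom.commutes, Algebra.algebraMap_eq_smul_one]
    rw [map_add, map_sub, pow_two, map_mul, hcoe, mul_assoc, Quaternion.coe_mul_eq_smul, two_mul,
      ← add_smul, map_smul, ← two_mul]
  have hs₁ : j (star s) * (j s * (SR * SL)) = (‖s‖ ^ 2) • (SR * SL) := by
    rw [← mul_assoc, map_star_mul_map, smul_mul_assoc, one_mul]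
  have hs₂ : j (star s) * (SR * (SL * j p))
      = (2 * s.re) • (SR * (SL * j p)) - j s * (SR * (SL * j p)) := by
    rw [map_star_eq_sub, sub_mul, smul_mul_assoc, one_mul]
  rw [mul_assoc SR (T - j p - 1) Pp, hKp, hKs, hpoly]
  simp only [mul_add, mul_sub, sub_mul, mul_assoc, mul_smul_comm, mul_one, one_mul,
    hs₁, hs₂]
  abel
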